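/- arXiv:1507.05342 — 4 statements merged into one kernel-verified Lean document; each statement's English description precedes it below -/
import Mathlib

section
/- For every θ ∈ (0, π/2) there exists a smooth map H : [0,1] × ℝ → S², 1-periodic in the second variable (a smooth family of smooth loops), such that: H(0,t) = β_θ(6πt); H(1,t) = κ(t), where κ(t) = (1, f(2πt))/√(1+‖f(2πt)‖²) is the spherical four-leaf clover; for every s ∈ [0,1] the loop H(s,·) is convex, i.e. ∂ₜH(s,t) ≠ 0 and det(H(s,t), ∂ₜH(s,t), ∂ₜ²H(s,t)) ≠ 0 for all t; and for every s, H(s,0) = (1,0,0) and ∂ₜH(s,0)/‖∂ₜH(s,0)‖ = (0,1,0) (the Frenet frame at the basepoint is the identity throughout the homotopy). -/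
open Real Set

/-- The Euclidean norm of a vector in ℝ³. -/
noncomputable def norm3 (v : Fin 3 → ℝ) : ℝ := Real.sqrt (v 0 ^ 2 + v 1 ^ 2 + v 2 ^ 2)

/-- Determinant of the 3×3 matrix with columns u, v, w. -/
def det3 (u v w : Fin 3 → ℝ) : ℝ :=
  u 0 * (v 1 * w 2 - v 2 * w 1) - u 1 * (v 0 * w 2 - v 2 * w 0) +
    u 2 * (v 0 * w 1 - v 1 * w 0)

/-- The kink curve β_θ(t) = (sin²θ + cos²θ·cos t, cos θ·sin t, sin θ·cos θ·(1−cos t)). -/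
noncomputable def betaKink (θ t : ℝ) : Fin 3 → ℝ :=
  ![Real.sin θ ^ 2 + Real.cos θ ^ 2 * Real.cos t,
    Real.cos θ * Real.sin t,
    Real.sin θ * Real.cos θ * (1 - Real.cos t)]

/-- The four-leaf clover plane curve f(t) = (cos t·sin 2t, sin t·sin 2t). -/
noncomputable def clover (t : ℝ) : Fin 2 → ℝ :=
  ![Real.cos t * Real.sin (2 * t), Real.sin t * Real.sin (2 * t)]

/-- The spherical four-leaf clover: κ(t) = (1, f(2πt))/√(1+‖f(2πt)‖²). -/
noncomputable def sphClover (t : ℝ) : Fin 3 → ℝ :=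
  (Real.sqrt (1 + (clover (2 * π * t) 0) ^ 2 + (clover (2 * π * t) 1) ^ 2))⁻¹ •
    ![1, clover (2 * π * t) 0, clover (2 * π * t) 1]

/-- The vector `(1 - mZ, bY, dZ)`, the image of `(1, Y, Z)` under a triangular matrix. -/
def triVec (m b d Y Z : ℝ) : Fin 3 → ℝ := ![1 - m * Z, b * Y, d * Z]

/-- First coordinate of the planar curve interpolating between a triple circle and the clover. -/
noncomputable def cloverY (a t : ℝ) : ℝ := (sin (3 * (2 * π * t)) + a * sin (2 * π * t)) / 2

/-- Second coordinate of the planar curve interpolating between a triple circle and the clover. -/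
noncomputable def cloverZ (a t : ℝ) : ℝ :=
  (1 - a + a * cos (2 * π * t) - cos (3 * (2 * π * t))) / 2

/-- The homotopy before projection to the sphere, with parameter `a`. -/
noncomputable def coneHomotopy (θ a t : ℝ) : Fin 3 → ℝ :=
  triVec (2 * (1 - a) * cos θ ^ 2) (a + (1 - a) * (2 * cos θ))
    (a + (1 - a) * (2 * (sin θ * cos θ))) (cloverY a t) (cloverZ a t)

lemma det3_smul_curve (p p' p'' : ℝ) (u v w : Fin 3 → ℝ) :
    det3 (p • u) (p • v + p' • u) (p • w + (2 * p') • v + p'' • u) = p ^ 3 * det3 u v w := by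
  simp only [det3, Pi.add_apply, Pi.smul_apply, smul_eq_mul]
  ring

lemma ne_zero_of_det3_ne_zero {u v w : Fin 3 → ℝ} (h : det3 u v w ≠ 0) : v ≠ 0 := by
  rintro rfl
  simp [det3] at h

/-- Multiplying a space curve by a nonvanishing smooth function preserves convexity. -/
lemma det3_deriv_smul_ne_zero {p : ℝ → ℝ} {G G₁ G₂ : ℝ → Fin 3 → ℝ}
    (hp : ContDiff ℝ (⊤ : ℕ∞) p) (hp0 : ∀ t, p t ≠ 0)
    (hG : ∀ t, HasDerivAt G (G₁ t) t) (hG₁ : ∀ t, HasDerivAt G₁ (G₂ t) t)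
    (h : ∀ t, det3 (G t) (G₁ t) (G₂ t) ≠ 0) (t : ℝ) :
    det3 (p t • G t) (deriv (fun τ => p τ • G τ) t)
      (deriv (deriv (fun τ => p τ • G τ)) t) ≠ 0 := by
  have hd : ∀ t, HasDerivAt p (deriv p t) t := fun t =>
    ((hp.differentiable (by simp)) t).hasDerivAt
  have hp' : ContDiff ℝ (⊤ : ℕ∞) (deriv p) := (contDiff_infty_iff_deriv.1 hp).2
  have hd' : ∀ t, HasDerivAt (deriv p) (deriv (deriv p) t) t := fun t =>
    ((hp'.differentiable (by simp)) t).hasDerivAt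
  have e₁ : deriv (fun τ => p τ • G τ) = fun τ => p τ • G₁ τ + deriv p τ • G τ :=
    funext fun τ => ((hd τ).smul (hG τ)).deriv
  have e₂ : deriv (fun τ => p τ • G₁ τ + deriv p τ • G τ) t =
      p t • G₂ t + (2 * deriv p t) • G₁ t + deriv (deriv p) t • G t := by
    have := (((hd t).smul (hG₁ t)).add ((hd' t).smul (hG t))).deriv
    refine this.trans ?_
    module
  rw [e₁, e₂, det3_smul_curve]
  exact mul_ne_zero (pow_ne_zero _ (hp0 t)) (h t)

lemma hasDerivAt_triVec {m b d Y' Z' t : ℝ} {Y Z : ℝ → ℝ} (hY : HasDerivAt Y Y' t)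
    (hZ : HasDerivAt Z Z' t) :
    HasDerivAt (fun τ => triVec m b d (Y τ) (Z τ)) ![-(m * Z'), b * Y', d * Z'] t := by
  rw [hasDerivAt_pi]
  intro i
  fin_cases i
  · simpa [triVec] using (hZ.const_mul m).const_sub 1
  · simpa [triVec] using hY.const_mul b
  · simpa [triVec] using hZ.const_mul d

lemma hasDerivAt_triVec_deriv {m b d Y' Z' t : ℝ} {Y Z : ℝ → ℝ} (hY : HasDerivAt Y Y' t)
    (hZ : HasDerivAt Z Z' t) :
    HasDerivAt (fun τ => ![-(m * Z τ), b * Y τ, d * Z τ]) ![-(m * Z'), b * Y', d * Z'] t := by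
  rw [hasDerivAt_pi]
  intro i
  fin_cases i
  · simpa using (hZ.const_mul m).fun_neg
  · simpa using hY.const_mul b
  · simpa using hZ.const_mul d

lemma det3_triVec (m b d Y Z Y₁ Z₁ Y₂ Z₂ : ℝ) :
    det3 (triVec m b d Y Z) ![-(m * Z₁), b * Y₁, d * Z₁] ![-(m * Z₂), b * Y₂, d * Z₂] =
      b * d * (Y₁ * Z₂ - Z₁ * Y₂) := by
  simp [det3, triVec]
  ring

lemma norm3_triVec_pos {m b d Y Z : ℝ} (hd : 0 < d) :
    0 < triVec m b d Y Z 0 ^ 2 + triVec m b d Y Z 1 ^ 2 + triVec m b d Y Z 2 ^ 2 := by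
  simp only [triVec, Matrix.cons_val_zero, Matrix.cons_val_one, Matrix.cons_val]
  by_cases hZ : Z = 0
  · subst hZ
    nlinarith [sq_nonneg (b * Y)]
  · have : 0 < (d * Z) ^ 2 := by positivity
    positivity

/-- The velocity components of the interpolating planar curve. -/
noncomputable def cloverY₁ (a t : ℝ) : ℝ :=
  π * (3 * cos (3 * (2 * π * t)) + a * cos (2 * π * t))

/-- See `cloverY₁`. -/
noncomputable def cloverZ₁ (a t : ℝ) : ℝ :=
  π * (3 * sin (3 * (2 * π * t)) - a * sin (2 * π * t))

lemma hasDerivAt_two_pi_mul (t : ℝ) : HasDerivAt (fun τ : ℝ => 2 * π * τ) (2 * π) t := by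
  simpa using (hasDerivAt_id t).const_mul (2 * π)

lemma hasDerivAt_cloverY (a t : ℝ) : HasDerivAt (cloverY a) (cloverY₁ a t) t := by
  have h := hasDerivAt_two_pi_mul t
  have := (((h.const_mul 3).sin).add (h.sin.const_mul a)).div_const 2
  exact this.congr_deriv (by rw [cloverY₁]; ring)

lemma hasDerivAt_cloverZ (a t : ℝ) : HasDerivAt (cloverZ a) (cloverZ₁ a t) t := by
  have h := hasDerivAt_two_pi_mul t
  have := (((h.cos.const_mul a).const_add (1 - a)).sub ((h.const_mul 3).cos)).div_const 2
  exact this.congr_deriv (by rw [cloverZ₁]; ring)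

lemma hasDerivAt_cloverY₁ (a t : ℝ) : HasDerivAt (cloverY₁ a)
    (-(2 * π ^ 2 * (9 * sin (3 * (2 * π * t)) + a * sin (2 * π * t)))) t := by
  have h := hasDerivAt_two_pi_mul t
  have := ((((h.const_mul 3).cos).const_mul 3).add (h.cos.const_mul a)).const_mul π
  exact this.congr_deriv (by ring)

lemma hasDerivAt_cloverZ₁ (a t : ℝ) : HasDerivAt (cloverZ₁ a)
    (2 * π ^ 2 * (9 * cos (3 * (2 * π * t)) - a * cos (2 * π * t))) t := by
  have h := hasDerivAt_two_pi_mul t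
  have := ((((h.const_mul 3).sin).const_mul 3).sub (h.sin.const_mul a)).const_mul π
  exact this.congr_deriv (by ring)

/-- The interpolating planar curve has positive curvature. -/
lemma clover_cross_pos {a : ℝ} (ha : a ∈ Icc (0 : ℝ) 1) (t : ℝ) :
    0 < cloverY₁ a t * (2 * π ^ 2 * (9 * cos (3 * (2 * π * t)) - a * cos (2 * π * t))) -
      cloverZ₁ a t * -(2 * π ^ 2 * (9 * sin (3 * (2 * π * t)) + a * sin (2 * π * t))) := by
  obtain ⟨h0, h1⟩ := ha
  have key : cloverY₁ a t * (2 * π ^ 2 * (9 * cos (3 * (2 * π * t)) - a * cos (2 * π * t))) -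
      cloverZ₁ a t * -(2 * π ^ 2 * (9 * sin (3 * (2 * π * t)) + a * sin (2 * π * t))) =
      2 * π ^ 3 * (27 - a ^ 2 + 6 * a * cos (3 * (2 * π * t) + 2 * π * t)) := by
    rw [cos_add, cloverY₁, cloverZ₁]
    linear_combination 54 * π ^ 3 * sin_sq_add_cos_sq (3 * (2 * π * t)) -
      2 * π ^ 3 * a ^ 2 * sin_sq_add_cos_sq (2 * π * t)
  rw [key]
  have hc := neg_one_le_cos (3 * (2 * π * t) + 2 * π * t)
  have : 0 < 27 - a ^ 2 + 6 * a * cos (3 * (2 * π * t) + 2 * π * t) := by nlinarith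
  positivity

lemma cloverY_add_one (a t : ℝ) : cloverY a (t + 1) = cloverY a t := by
  have h : 3 * (2 * π * (t + 1)) = 3 * (2 * π * t) + (3 : ℕ) * (2 * π) := by push_cast; ring
  rw [cloverY, cloverY, h, sin_add_nat_mul_two_pi, mul_add, mul_one, sin_add_two_pi]

lemma cloverZ_add_one (a t : ℝ) : cloverZ a (t + 1) = cloverZ a t := by
  have h : 3 * (2 * π * (t + 1)) = 3 * (2 * π * t) + (3 : ℕ) * (2 * π) := by push_cast; ring
  rw [cloverZ, cloverZ, h, cos_add_nat_mul_two_pi, mul_add, mul_one, cos_add_two_pi]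

lemma cloverY_one (t : ℝ) : cloverY 1 t = clover (2 * π * t) 0 := by
  simp only [cloverY, clover, Matrix.cons_val_zero]
  rw [sin_three_mul, sin_two_mul]
  linear_combination -2 * sin (2 * π * t) * sin_sq_add_cos_sq (2 * π * t)

lemma cloverZ_one (t : ℝ) : cloverZ 1 t = clover (2 * π * t) 1 := by
  simp only [cloverZ, clover, Matrix.cons_val_one, Matrix.cons_val_zero]
  rw [cos_three_mul, sin_two_mul]
  linear_combination -2 * cos (2 * π * t) * sin_sq_add_cos_sq (2 * π * t)

lemma coneHomotopy_zero (θ t : ℝ) : coneHomotopy θ 0 t = betaKink θ (6 * π * t) := by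
  have h : 3 * (2 * π * t) = 6 * π * t := by ring
  ext i
  fin_cases i
  · simp [coneHomotopy, triVec, betaKink, cloverZ, h]
    linear_combination -sin_sq_add_cos_sq θ
  · simp [coneHomotopy, triVec, betaKink, cloverY, h]
    ring
  · simp [coneHomotopy, triVec, betaKink, cloverZ, h]
    ring

lemma coneHomotopy_one (θ t : ℝ) :
    coneHomotopy θ 1 t = ![1, clover (2 * π * t) 0, clover (2 * π * t) 1] := by
  simp [coneHomotopy, triVec, cloverY_one, cloverZ_one]

lemma norm3_betaKink (θ t : ℝ) : norm3 (betaKink θ t) = 1 := by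
  simp only [norm3, betaKink, Matrix.cons_val_zero, Matrix.cons_val_one, Matrix.cons_val]
  rw [sqrt_eq_one]
  have h := sin_sq_add_cos_sq θ
  have h' := sin_sq_add_cos_sq t
  have e : sin θ ^ 2 = 1 - cos θ ^ 2 := by linarith
  have e' : sin t ^ 2 = 1 - cos t ^ 2 := by linarith
  simp only [mul_pow, e, e']
  ring

lemma norm3_inv_smul {v : Fin 3 → ℝ} (h : 0 < norm3 v) : norm3 ((norm3 v)⁻¹ • v) = 1 := by
  have hs : norm3 v ^ 2 = v 0 ^ 2 + v 1 ^ 2 + v 2 ^ 2 := sq_sqrt (by positivity)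
  rw [norm3, sqrt_eq_one]
  simp only [Pi.smul_apply, smul_eq_mul, mul_pow, ← mul_add, ← hs]
  field_simp

lemma hasDerivAt_norm3_inv {G : ℝ → Fin 3 → ℝ} {v : Fin 3 → ℝ} {t : ℝ}
    (hG : HasDerivAt G v t) (h : 0 < norm3 (G t))
    (horth : G t 0 * v 0 + G t 1 * v 1 + G t 2 * v 2 = 0) :
    HasDerivAt (fun τ => (norm3 (G τ))⁻¹) 0 t := by
  have hc := hasDerivAt_pi.1 hG
  have hQ : HasDerivAt (fun τ => G τ 0 ^ 2 + G τ 1 ^ 2 + G τ 2 ^ 2) 0 t :=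
    ((((hc 0).pow 2).add ((hc 1).pow 2)).add ((hc 2).pow 2)).congr_deriv (by
      norm_num
      linear_combination 2 * horth)
  have hs : HasDerivAt (fun τ => norm3 (G τ)) 0 t :=
    (hQ.sqrt (sqrt_pos.1 h).ne').congr_deriv (by simp)
  exact (hs.fun_inv h.ne').congr_deriv (by simp)

lemma det3_deriv_coneHomotopy_ne_zero {θ a : ℝ} {p : ℝ → ℝ} (ha : a ∈ Icc (0 : ℝ) 1)
    (hb : 0 < a + (1 - a) * (2 * cos θ)) (hd : 0 < a + (1 - a) * (2 * (sin θ * cos θ)))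
    (hp : ContDiff ℝ (⊤ : ℕ∞) p) (hp0 : ∀ t, p t ≠ 0) (t : ℝ) :
    det3 (p t • coneHomotopy θ a t) (deriv (fun τ => p τ • coneHomotopy θ a τ) t)
      (deriv (deriv (fun τ => p τ • coneHomotopy θ a τ)) t) ≠ 0 := by
  refine det3_deriv_smul_ne_zero hp hp0
    (fun τ => hasDerivAt_triVec (hasDerivAt_cloverY a τ) (hasDerivAt_cloverZ a τ))
    (fun τ => hasDerivAt_triVec_deriv (hasDerivAt_cloverY₁ a τ) (hasDerivAt_cloverZ₁ a τ))
    (fun τ => ?_) t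
  have := (mul_pos (mul_pos hb hd) (clover_cross_pos ha τ)).ne'
  rwa [← det3_triVec (2 * (1 - a) * cos θ ^ 2) _ _ (cloverY a τ) (cloverZ a τ)] at this

lemma contDiff_section {F : ℝ × ℝ → ℝ} (hF : ContDiff ℝ (⊤ : ℕ∞) F) (s : ℝ) :
    ContDiff ℝ (⊤ : ℕ∞) fun τ => F (s, τ) :=
  hF.comp (contDiff_prodMk_right s)

lemma coneHomotopy_basepoint (θ a : ℝ) : coneHomotopy θ a 0 = ![1, 0, 0] := by
  simp [coneHomotopy, triVec, cloverY, cloverZ]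

lemma hasDerivAt_coneHomotopy_basepoint (θ a : ℝ) : HasDerivAt (coneHomotopy θ a)
    ![0, (a + (1 - a) * (2 * cos θ)) * (π * (3 + a)), 0] 0 := by
  have h : HasDerivAt (coneHomotopy θ a) _ 0 :=
    hasDerivAt_triVec (hasDerivAt_cloverY a 0) (hasDerivAt_cloverZ a 0)
  exact h.congr_deriv (by simp [cloverY₁, cloverZ₁])

lemma coneHomotopy_frame {θ a : ℝ} (ha : 0 ≤ a) (hb : 0 < a + (1 - a) * (2 * cos θ)) :
    (norm3 (coneHomotopy θ a 0))⁻¹ • coneHomotopy θ a 0 = ![1, 0, 0] ∧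
    (norm3 (deriv (fun τ => (norm3 (coneHomotopy θ a τ))⁻¹ • coneHomotopy θ a τ) 0))⁻¹ •
      deriv (fun τ => (norm3 (coneHomotopy θ a τ))⁻¹ • coneHomotopy θ a τ) 0 =
        ![0, 1, 0] := by
  have hn : norm3 ![1, 0, 0] = 1 := by simp [norm3]
  have hG := hasDerivAt_coneHomotopy_basepoint θ a
  have hpos : 0 < (a + (1 - a) * (2 * cos θ)) * (π * (3 + a)) := by positivity
  generalize (a + (1 - a) * (2 * cos θ)) * (π * (3 + a)) = q at hG hpos
  have hp : HasDerivAt (fun τ => (norm3 (coneHomotopy θ a τ))⁻¹) 0 0 :=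
    hasDerivAt_norm3_inv hG (by simp [coneHomotopy_basepoint, hn])
      (by simp [coneHomotopy_basepoint])
  have hd : deriv (fun τ => (norm3 (coneHomotopy θ a τ))⁻¹ • coneHomotopy θ a τ) 0 =
      ![0, q, 0] :=
    (hp.smul hG).deriv.trans (by simp [coneHomotopy_basepoint, hn])
  have hq : norm3 ![0, q, 0] = q := by simp [norm3, sqrt_sq hpos.le]
  refine ⟨by simp [coneHomotopy_basepoint, hn], ?_⟩
  rw [hd, hq]
  simp [hpos.ne']

/-- for θ ∈ (0,π/2) there is a smooth homotopy, through convex spherical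
loops with fixed Frenet frame at the basepoint, from the kink β_θ(6πt) to the spherical
four-leaf clover. -/
theorem kink_homotopic_to_clover (θ : ℝ) (hθ : θ ∈ Set.Ioo 0 (π / 2)) :
    ∃ H : ℝ × ℝ → Fin 3 → ℝ,
      ContDiff ℝ (⊤ : ℕ∞) H ∧
      (∀ s ∈ Set.Icc (0:ℝ) 1, ∀ t : ℝ, norm3 (H (s, t)) = 1) ∧
      (∀ s ∈ Set.Icc (0:ℝ) 1, ∀ t : ℝ, H (s, t + 1) = H (s, t)) ∧
      (∀ t : ℝ, H (0, t) = betaKink θ (6 * π * t)) ∧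
      (∀ t : ℝ, H (1, t) = sphClover t) ∧
      (∀ s ∈ Set.Icc (0:ℝ) 1, ∀ t : ℝ,
        deriv (fun τ => H (s, τ)) t ≠ 0 ∧
        det3 (H (s, t)) (deriv (fun τ => H (s, τ)) t)
          (deriv (deriv (fun τ => H (s, τ))) t) ≠ 0) ∧
      (∀ s ∈ Set.Icc (0:ℝ) 1,
        H (s, 0) = ![1, 0, 0] ∧
        (norm3 (deriv (fun τ => H (s, τ)) 0))⁻¹ • deriv (fun τ => H (s, τ)) 0
          = ![0, 1, 0]) := by
  obtain ⟨hθ0, hθ1⟩ := hθ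
  have hcos : 0 < cos θ := cos_pos_of_mem_Ioo ⟨by linarith, hθ1⟩
  have hsin : 0 < sin θ := sin_pos_of_pos_of_lt_pi hθ0 (by linarith [pi_pos])
  have hcoef : ∀ {q a : ℝ}, 0 < q → a ∈ Icc (0 : ℝ) 1 → 0 < a + (1 - a) * (2 * q) := by
    rintro q a hq ⟨h0, h1⟩
    rcases h0.eq_or_lt with rfl | h0
    · linarith
    · have : 0 ≤ (1 - a) * (2 * q) := mul_nonneg (by linarith) (by linarith)
      linarith
  have hmem : ∀ s, smoothTransition s ∈ Icc (0 : ℝ) 1 := fun s =>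
    ⟨smoothTransition.nonneg s, smoothTransition.le_one s⟩
  have hQ : ∀ s t, 0 < coneHomotopy θ (smoothTransition s) t 0 ^ 2 +
      coneHomotopy θ (smoothTransition s) t 1 ^ 2 +
      coneHomotopy θ (smoothTransition s) t 2 ^ 2 := fun s t =>
    norm3_triVec_pos (hcoef (mul_pos hsin hcos) (hmem s))
  have hN : ∀ s t, 0 < norm3 (coneHomotopy θ (smoothTransition s) t) := fun s t =>
    sqrt_pos.2 (hQ s t)
  have hG : ContDiff ℝ (⊤ : ℕ∞)
      (fun x : ℝ × ℝ => coneHomotopy θ (smoothTransition x.1) x.2) := by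
    rw [contDiff_pi]
    intro i
    fin_cases i <;> simp [coneHomotopy, triVec, cloverY, cloverZ] <;> fun_prop
  have hp : ContDiff ℝ (⊤ : ℕ∞)
      (fun x : ℝ × ℝ => (norm3 (coneHomotopy θ (smoothTransition x.1) x.2))⁻¹) := by
    refine ContDiff.inv (ContDiff.sqrt ?_ fun x => (hQ x.1 x.2).ne') fun x => (hN x.1 x.2).ne'
    have h := contDiff_pi.1 hG
    exact (((h 0).pow 2).add ((h 1).pow 2)).add ((h 2).pow 2)
  refine ⟨fun x => (norm3 (coneHomotopy θ (smoothTransition x.1) x.2))⁻¹ •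
    coneHomotopy θ (smoothTransition x.1) x.2, hp.smul hG, fun s _ t => norm3_inv_smul (hN s t),
    fun s _ t => ?_, fun t => ?_, fun t => ?_, fun s _ t => ?_, fun s _ => ?_⟩
  · simp only [coneHomotopy, cloverY_add_one, cloverZ_add_one]
  · simp [smoothTransition.zero, coneHomotopy_zero, norm3_betaKink]
  · simp only [smoothTransition.one, coneHomotopy_one]
    simp [sphClover, norm3]
  · have hps : ContDiff ℝ (⊤ : ℕ∞)
        (fun τ => (norm3 (coneHomotopy θ (smoothTransition s) τ))⁻¹) :=
      contDiff_section hp s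
    have key := det3_deriv_coneHomotopy_ne_zero (hmem s) (hcoef hcos (hmem s))
      (hcoef (mul_pos hsin hcos) (hmem s)) hps (fun τ => (inv_pos.2 (hN s τ)).ne') t
    exact ⟨ne_zero_of_det3_ne_zero key, key⟩
  · exact coneHomotopy_frame (hmem s).1 (hcoef hcos (hmem s))
end

section
/- Fix ρ with 0 < ρ < 2ρ < 1. Let c : D³ × [0,1] → ℝ be smooth with ∂ₜc > 0 on a neighbourhood of ∂(D³ × [0,1]), and let K > 0 satisfy K < min over p ∈ ∂D³ of (c(p,1) − c(p,0)). Then there exists a smooth function c′ : D³ × [0,1] → ℝ which is K-radial — i.e. (a) t ↦ c′(p,t) is nondecreasing on [0,2ρ] and c′(p,t) = c′(p,ρ) + K(t−ρ)/ρ for t ∈ [ρ,2ρ]; (b) c′(p,t) − c′(p,ρ) depends on p only through |p|; (c) c′(p,t) is independent of p for p in a neighbourhood of 0 — which satisfies ∂ₜc′ > 0 on a neighbourhood of ∂(D³ × [0,1]) and such that c(p,0) ≤ c′(p,0) and c′(p,1) ≤ c(p,1) for every p ∈ D³ (the angular shell of c dominates the K-radial shell of c′). -/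
open Real Set

/-- The closed unit ball D³ ⊂ ℝ³. -/
def ball3 : Set (Fin 3 → ℝ) := {p | p 0 ^ 2 + p 1 ^ 2 + p 2 ^ 2 ≤ 1}

/-- The boundary ∂(D³ × [0,1]). -/
def bdry3 : Set ((Fin 3 → ℝ) × ℝ) :=
  {q | (q.1 ∈ ball3 ∧ q.2 ∈ Set.Icc 0 1) ∧
    (q.1 0 ^ 2 + q.1 1 ^ 2 + q.1 2 ^ 2 = 1 ∨ q.2 = 0 ∨ q.2 = 1)}

/-- Partial derivative in the t-direction of a function on ℝ³ × ℝ. -/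
noncomputable def dt (c : ((Fin 3 → ℝ) × ℝ) → ℝ) (q : (Fin 3 → ℝ) × ℝ) : ℝ :=
  deriv (fun τ => c (q.1, τ)) q.2

open intervalIntegral in
lemma integral_le_mul_of_le {g : ℝ → ℝ} (hg : Continuous g) {a b m : ℝ} (hab : a ≤ b)
    (h : ∀ t ∈ Icc a b, g t ≤ m) : ∫ t in a..b, g t ≤ m * (b - a) := by
  have := integral_mono_on hab (hg.intervalIntegrable a b)
    (continuous_const.intervalIntegrable (μ := MeasureTheory.volume) a b) h
  simpa [mul_comm] using this

/-- A primitive of a smooth function is smooth. -/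
lemma contDiff_primitive {g : ℝ → ℝ} (hg : ContDiff ℝ (⊤ : ℕ∞) g) (a : ℝ) :
    ContDiff ℝ (⊤ : ℕ∞) (fun t => ∫ x in a..t, g x) := by
  have hd : ∀ t, HasDerivAt (fun t => ∫ x in a..t, g x) (g t) t := fun t =>
    hg.continuous.integral_hasStrictDerivAt a t |>.hasDerivAt
  refine contDiff_infty_iff_deriv.2 ⟨fun t => (hd t).differentiableAt, ?_⟩
  rwa [show deriv (fun t => ∫ x in a..t, g x) = g from funext fun t => (hd t).deriv]

/-- A smooth function with positive derivative, of slope `K / ρ` on `[ρ, 2ρ]`, whose variation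
on `[0, 1]` exceeds `K` by at most `ε`. -/
lemma exists_smooth_profile {ρ K ε : ℝ} (hρ₀ : 0 < ρ) (hρ₁ : 2 * ρ < 1) (hK : 0 < K)
    (hε : 0 < ε) :
    ∃ h : ℝ → ℝ, ContDiff ℝ (⊤ : ℕ∞) h ∧ (∀ t, 0 < deriv h t) ∧
      (∀ t ∈ Icc ρ (2 * ρ), h t = h ρ + K * (t - ρ) / ρ) ∧ h 1 - h 0 ≤ K + ε := by
  obtain ⟨L, hL, hLK⟩ : ∃ L : ℝ, 0 < L ∧ L * ρ = K := ⟨K / ρ, by positivity, by field_simp⟩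
  obtain ⟨s, hs, hsL, hsε⟩ : ∃ s : ℝ, 0 < s ∧ s ≤ L ∧ s ≤ ε / 2 :=
    ⟨min L (ε / 2), by positivity, min_le_left _ _, min_le_right _ _⟩
  obtain ⟨η, hη, hηρ, hη1, hηε⟩ :
      ∃ η : ℝ, 0 < η ∧ η ≤ ρ ∧ η ≤ 1 - 2 * ρ ∧ L * η ≤ ε / 4 := by
    have : 0 < 1 - 2 * ρ := by linarith
    refine ⟨min (min ρ (1 - 2 * ρ)) (ε / 4 / L), by positivity,
      (min_le_left _ _).trans (min_le_left _ _), (min_le_left _ _).trans (min_le_right _ _), ?_⟩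
    calc L * min (min ρ (1 - 2 * ρ)) (ε / 4 / L) ≤ L * (ε / 4 / L) := by
          gcongr; exact min_le_right _ _
      _ = ε / 4 := by field_simp
  let b : ℝ → ℝ := fun t =>
    smoothTransition ((t - ρ + η) / η) * smoothTransition ((2 * ρ + η - t) / η)
  have hb : ContDiff ℝ (⊤ : ℕ∞) b :=
    (smoothTransition.contDiff.comp (by fun_prop)).mul
      (smoothTransition.contDiff.comp (by fun_prop))
  have hb0 : ∀ t, 0 ≤ b t := fun t =>
    mul_nonneg (smoothTransition.nonneg _) (smoothTransition.nonneg _)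
  have hb1 : ∀ t, b t ≤ 1 := fun t =>
    mul_le_one₀ (smoothTransition.le_one _) (smoothTransition.nonneg _)
      (smoothTransition.le_one _)
  let g : ℝ → ℝ := fun t => s + (L - s) * b t
  have hg : ContDiff ℝ (⊤ : ℕ∞) g := contDiff_const.add (contDiff_const.mul hb)
  have hgs : ∀ t, s ≤ g t := fun t => by
    have := mul_nonneg (sub_nonneg.2 hsL) (hb0 t)
    simp only [g]; linarith
  have hgL : ∀ t, g t ≤ L := fun t => by
    have := mul_le_mul_of_nonneg_left (hb1 t) (sub_nonneg.2 hsL)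
    simp only [g]; linarith
  have hi : ∀ x y, IntervalIntegrable g MeasureTheory.volume x y :=
    fun x y => hg.continuous.intervalIntegrable x y
  refine ⟨fun t => ∫ x in ρ..t, g x, contDiff_primitive hg ρ, fun t => ?_, fun t ht => ?_, ?_⟩
  · rw [hg.continuous.deriv_integral]
    exact hs.trans_le (hgs t)
  · have hgc : ∀ x ∈ uIcc ρ t, g x = L := by
      intro x hx
      rw [uIcc_of_le ht.1] at hx
      have h1 : 1 ≤ (x - ρ + η) / η := by rw [le_div_iff₀ hη]; linarith [hx.1]
      have h2 : 1 ≤ (2 * ρ + η - x) / η := by rw [le_div_iff₀ hη]; linarith [hx.2, ht.2]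
      simp only [g, b, smoothTransition.one_of_one_le h1, smoothTransition.one_of_one_le h2]
      ring
    simp only [intervalIntegral.integral_congr hgc, intervalIntegral.integral_const,
      intervalIntegral.integral_same, smul_eq_mul, ← hLK]
    field_simp
    ring
  · have e1 : ∫ x in (0 : ℝ)..(ρ - η), g x ≤ s * (ρ - η - 0) := by
      refine integral_le_mul_of_le hg.continuous (by linarith) fun t ht => ?_
      have : (t - ρ + η) / η ≤ 0 := div_nonpos_of_nonpos_of_nonneg (by linarith [ht.2]) hη.le
      simp [g, b, smoothTransition.zero_of_nonpos this]
    have e2 : ∫ x in (ρ - η)..(2 * ρ + η), g x ≤ L * (2 * ρ + η - (ρ - η)) :=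
      integral_le_mul_of_le hg.continuous (by linarith) fun t _ => hgL t
    have e3 : ∫ x in (2 * ρ + η)..1, g x ≤ s * (1 - (2 * ρ + η)) := by
      refine integral_le_mul_of_le hg.continuous (by linarith) fun t ht => ?_
      have : (2 * ρ + η - t) / η ≤ 0 := div_nonpos_of_nonpos_of_nonneg (by linarith [ht.1]) hη.le
      simp [g, b, smoothTransition.zero_of_nonpos this]
    have split : (∫ x in ρ..1, g x) - ∫ x in ρ..0, g x =
        (∫ x in (0 : ℝ)..(ρ - η), g x) + (∫ x in (ρ - η)..(2 * ρ + η), g x) +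
          ∫ x in (2 * ρ + η)..1, g x := by
      rw [intervalIntegral.integral_add_adjacent_intervals (hi _ _) (hi _ _),
        intervalIntegral.integral_add_adjacent_intervals (hi _ _) (hi _ _),
        intervalIntegral.integral_interval_sub_left (hi _ _) (hi _ _)]
    simp only [split]
    nlinarith [mul_pos hs hρ₀, mul_pos hs hη]

/-- A smooth step function: `0` up to `a`, `1` from `b` on. -/
lemma exists_smooth_step {a b : ℝ} (hab : a < b) :
    ∃ S : ℝ → ℝ, ContDiff ℝ (⊤ : ℕ∞) S ∧ (∀ t ≤ a, S t = 0) ∧ (∀ t, b ≤ t → S t = 1) ∧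
      ∀ t, 0 ≤ S t ∧ S t ≤ 1 := by
  have hba : 0 < b - a := sub_pos.2 hab
  refine ⟨fun t => smoothTransition ((t - a) / (b - a)),
    smoothTransition.contDiff.comp (by fun_prop), fun t ht => ?_, fun t ht => ?_,
    fun t => ⟨smoothTransition.nonneg _, smoothTransition.le_one _⟩⟩
  · exact smoothTransition.zero_of_nonpos
      (div_nonpos_of_nonpos_of_nonneg (by linarith) hba.le)
  · exact smoothTransition.one_of_one_le (by rw [le_div_iff₀ hba]; linarith)

lemma isCompact_ball3 : IsCompact ball3 := by
  refine (isCompact_univ_pi fun _ : Fin 3 => isCompact_Icc (a := (-1 : ℝ)) (b := 1)).of_isClosed_subset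
    (isClosed_le (by fun_prop) continuous_const) fun p hp i _ => ?_
  simp only [ball3, mem_ofPred_eq] at hp
  refine abs_le.1 ((sq_le_one_iff_abs_le_one (p i)).1 ?_)
  fin_cases i <;> simp only [Fin.zero_eta, Fin.mk_one, Fin.reduceFinMk] <;>
    linarith [sq_nonneg (p 0), sq_nonneg (p 1), sq_nonneg (p 2)]

/-- A positive lower bound on the unit sphere persists on a collar of the sphere. -/
lemma exists_collar_lower_bound {f : (Fin 3 → ℝ) → ℝ} (hf : Continuous f) {K : ℝ}
    (h : ∀ p : Fin 3 → ℝ, p 0 ^ 2 + p 1 ^ 2 + p 2 ^ 2 = 1 → K < f p) :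
    ∃ ε > 0, ∃ r, 0 < r ∧ r < 1 ∧
      ∀ p ∈ ball3, r < p 0 ^ 2 + p 1 ^ 2 + p 2 ^ 2 → K + ε ≤ f p := by
  have hn : Continuous fun p : Fin 3 → ℝ => p 0 ^ 2 + p 1 ^ 2 + p 2 ^ 2 := by fun_prop
  have hS : IsCompact {p : Fin 3 → ℝ | p 0 ^ 2 + p 1 ^ 2 + p 2 ^ 2 = 1} :=
    isCompact_ball3.of_isClosed_subset (isClosed_eq hn continuous_const) fun p hp => le_of_eq hp
  obtain ⟨K', hK', hK'f⟩ := hS.exists_forall_le' hf.continuousOn h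
  have hT : IsCompact (ball3 ∩ {p | f p ≤ (K + K') / 2}) :=
    isCompact_ball3.inter_right (isClosed_le hf continuous_const)
  obtain ⟨a, ha, haT⟩ := hT.exists_forall_le' (a := -1) hn.neg.continuousOn (by
    rintro p ⟨hp, hpf⟩
    refine neg_lt_neg (lt_of_le_of_ne hp fun hp1 => ?_)
    have := hK'f p hp1
    simp only [mem_ofPred_eq] at hpf
    linarith)
  refine ⟨(K' - K) / 2, by linarith, max (-a) (1 / 2), by positivity,
    max_lt (by linarith) (by norm_num), fun p hp hr => ?_⟩
  by_contra! hlt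
  have : a ≤ -(p 0 ^ 2 + p 1 ^ 2 + p 2 ^ 2) := haT p ⟨hp, by simp only [mem_ofPred_eq]; linarith⟩
  linarith [le_max_left (-a) (1 / 2)]

/-- any angular shell whose boundary angle variation exceeds K dominates a
K-radial shell. -/
theorem domination_by_radial_shell
    (ρ : ℝ) (hρ₀ : 0 < ρ) (hρ₁ : 2 * ρ < 1)
    (c : ((Fin 3 → ℝ) × ℝ) → ℝ) (hc : ContDiff ℝ (⊤ : ℕ∞) c)
    (hbd : ∃ V : Set ((Fin 3 → ℝ) × ℝ), IsOpen V ∧ bdry3 ⊆ V ∧ ∀ q ∈ V, 0 < dt c q)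
    (K : ℝ) (hK : 0 < K)
    (hKlt : ∀ p : Fin 3 → ℝ, p 0 ^ 2 + p 1 ^ 2 + p 2 ^ 2 = 1 → K < c (p, 1) - c (p, 0)) :
    ∃ c' : ((Fin 3 → ℝ) × ℝ) → ℝ,
      ContDiff ℝ (⊤ : ℕ∞) c' ∧
      -- (a) nondecreasing on [0,2ρ], linear of slope K/ρ on [ρ,2ρ]
      (∀ p ∈ ball3, MonotoneOn (fun t => c' (p, t)) (Set.Icc 0 (2 * ρ))) ∧
      (∀ p ∈ ball3, ∀ t ∈ Set.Icc ρ (2 * ρ),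
        c' (p, t) = c' (p, ρ) + K * (t - ρ) / ρ) ∧
      -- (b) c'(p,t) − c'(p,ρ) depends on p only through |p|
      (∀ p ∈ ball3, ∀ p' ∈ ball3, norm3 p = norm3 p' →
        ∀ t ∈ Set.Icc (0:ℝ) 1, c' (p, t) - c' (p, ρ) = c' (p', t) - c' (p', ρ)) ∧
      -- (c) c'(p,t) independent of p near p = 0
      (∃ δ > (0:ℝ), ∀ p : Fin 3 → ℝ, norm3 p ≤ δ →
        ∀ t ∈ Set.Icc (0:ℝ) 1, c' (p, t) = c' ((0 : Fin 3 → ℝ), t)) ∧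
      -- c' is an angular (Engel) shell
      (∃ V : Set ((Fin 3 → ℝ) × ℝ), IsOpen V ∧ bdry3 ⊆ V ∧ ∀ q ∈ V, 0 < dt c' q) ∧
      -- domination
      (∀ p ∈ ball3, c (p, 0) ≤ c' (p, 0) ∧ c' (p, 1) ≤ c (p, 1)) := by
  have hn : ContDiff ℝ (⊤ : ℕ∞) fun p : Fin 3 → ℝ => p 0 ^ 2 + p 1 ^ 2 + p 2 ^ 2 := by fun_prop
  have hc0 : ContDiff ℝ (⊤ : ℕ∞) fun p : Fin 3 → ℝ => c (p, 0) := hc.comp (by fun_prop)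
  have hc1 : ContDiff ℝ (⊤ : ℕ∞) fun p : Fin 3 → ℝ => c (p, 1) := hc.comp (by fun_prop)
  obtain ⟨ε, hε, r, hr0, hr1, hr⟩ :=
    exists_collar_lower_bound (f := fun p => c (p, 1) - c (p, 0))
      (hc1.continuous.sub hc0.continuous) hKlt
  obtain ⟨h, hh, hh', hhlin, hh1⟩ := exists_smooth_profile hρ₀ hρ₁ hK hε
  have hmono : StrictMono h := strictMono_of_deriv_pos hh'
  obtain ⟨S, hS, hS0, hS1, -⟩ := exists_smooth_step (a := 2 * ρ) (b := (2 * ρ + 1) / 2)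
    (by linarith)
  obtain ⟨ψ, hψ, hψ0, hψ1, hψ01⟩ := exists_smooth_step (a := r) (b := (r + 1) / 2) (by linarith)
  obtain ⟨B₀, hB₀⟩ := isCompact_ball3.exists_bound_of_continuousOn hc0.continuous.continuousOn
  obtain ⟨B₁, hB₁⟩ := isCompact_ball3.exists_bound_of_continuousOn hc1.continuous.continuousOn
  obtain ⟨n, hndef⟩ : ∃ n : (Fin 3 → ℝ) → ℝ, n = fun p => p 0 ^ 2 + p 1 ^ 2 + p 2 ^ 2 := ⟨_, rfl⟩
  rw [← hndef] at hn
  obtain ⟨M, hM⟩ : ∃ M, M = 2 * B₀ + B₁ + h 1 - h 0 := ⟨_, rfl⟩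
  let c' : (Fin 3 → ℝ) × ℝ → ℝ := fun q =>
    h q.2 + ψ (n q.1) * (c (q.1, 0) - h 0) + (1 - ψ (n q.1)) * (B₀ - h 0 - M * S q.2)
  have early : ∀ p, ∀ t ≤ 2 * ρ, c' (p, t) =
      h t + (ψ (n p) * (c (p, 0) - h 0) + (1 - ψ (n p)) * (B₀ - h 0)) := fun p t ht => by
    simp only [c', hS0 t ht]; ring
  have late : ∀ p, ∀ t, (2 * ρ + 1) / 2 ≤ t → c' (p, t) =
      h t + (ψ (n p) * (c (p, 0) - h 0) + (1 - ψ (n p)) * (B₀ - h 0 - M)) := fun p t ht => by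
    simp only [c', hS1 t ht]; ring
  have outer : ∀ p, (r + 1) / 2 ≤ n p → ∀ t, c' (p, t) = h t + (c (p, 0) - h 0) :=
    fun p hp t => by
    simp only [c', hψ1 _ hp]; ring
  have inner : ∀ p, n p ≤ r → ∀ t, c' (p, t) = h t + (B₀ - h 0 - M * S t) := fun p hp t => by
    simp only [c', hψ0 _ hp]; ring
  have norm3_eq : ∀ p, norm3 p = √(n p) := fun p => by rw [hndef]; rfl
  have n_nonneg : ∀ p, 0 ≤ n p := fun p => by rw [hndef]; positivity
  have dt_pos : ∀ (q : (Fin 3 → ℝ) × ℝ) (a : ℝ) (U : Set ℝ), IsOpen U → q.2 ∈ U →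
      (∀ t ∈ U, c' (q.1, t) = h t + a) → 0 < dt c' q := by
    intro q a U hU hq heq
    have : (fun t => c' (q.1, t)) =ᶠ[nhds q.2] fun t => h t + a :=
      Filter.eventually_of_mem (hU.mem_nhds hq) heq
    rw [dt, this.deriv_eq, deriv_add_const]
    exact hh' _
  refine ⟨c', ?_, ?_, ?_, ?_, ⟨√r, by positivity, ?_⟩,
    ⟨{q | q.2 < 2 * ρ} ∪ {q | (2 * ρ + 1) / 2 < q.2} ∪ {q | (r + 1) / 2 < n q.1}, ?_, ?_, ?_⟩, ?_⟩
  · have hψn : ContDiff ℝ (⊤ : ℕ∞) fun q : (Fin 3 → ℝ) × ℝ => ψ (n q.1) :=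
      hψ.comp (hn.comp contDiff_fst)
    exact ((hh.comp contDiff_snd).add (hψn.mul ((hc0.comp contDiff_fst).sub contDiff_const))).add
      ((contDiff_const.sub hψn).mul
        (contDiff_const.sub (contDiff_const.mul (hS.comp contDiff_snd))))
  · intro p _ t ht u hu htu
    simp only [early p t ht.2, early p u hu.2]
    linarith [hmono.monotone htu]
  · intro p _ t ht
    rw [early p t ht.2, early p ρ (by linarith), hhlin t ht]
    ring
  · intro p _ p' _ hpp t _
    have hnn : n p = n p' := by
      rwa [norm3_eq, norm3_eq, Real.sqrt_inj (n_nonneg p) (n_nonneg p')] at hpp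
    simp only [c', hnn]
    ring
  · intro p hp t _
    rw [norm3_eq] at hp
    have h0 : n 0 = 0 := by simp [hndef]
    rw [inner p ((Real.sqrt_le_sqrt_iff hr0.le).1 hp), inner 0 (by rw [h0]; exact hr0.le)]
  · exact ((isOpen_lt continuous_snd continuous_const).union
      (isOpen_lt continuous_const continuous_snd)).union
      (isOpen_lt continuous_const (hn.continuous.comp continuous_fst))
  · rintro q ⟨-, hq | hq | hq⟩
    · refine Or.inr ?_
      simp only [mem_ofPred_eq, hndef, hq]
      linarith
    · refine Or.inl (Or.inl ?_)
      simp only [mem_ofPred_eq, hq]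
      linarith
    · refine Or.inl (Or.inr ?_)
      simp only [mem_ofPred_eq, hq]
      linarith
  · rintro q ((hq | hq) | hq)
    · exact dt_pos q _ (Iio (2 * ρ)) isOpen_Iio hq fun t ht => early q.1 t (le_of_lt ht)
    · exact dt_pos q _ (Ioi ((2 * ρ + 1) / 2)) isOpen_Ioi hq fun t ht =>
        late q.1 t (le_of_lt ht)
    · exact dt_pos q _ univ isOpen_univ (mem_univ _) fun t _ => outer q.1 (le_of_lt hq) t
  · intro p hp
    have b0 := abs_le.1 (hB₀ p hp)
    have b1 := abs_le.1 (hB₁ p hp)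
    obtain ⟨hψ_nonneg, hψ_le⟩ := hψ01 (n p)
    constructor
    · rw [early p 0 (by linarith)]
      nlinarith [mul_nonneg (sub_nonneg.2 hψ_le) (sub_nonneg.2 b0.2)]
    · rcases le_or_gt (n p) r with hpr | hpr
      · rw [inner p hpr, hS1 1 (by linarith), hM]
        linarith
      · have hcol := hr p hp (by simpa only [hndef] using hpr)
        rw [late p 1 (by linarith), hM]
        have h01 : h 0 < h 1 := hmono one_pos
        nlinarith [mul_nonneg (sub_nonneg.2 hψ_le)
          (show 0 ≤ c (p, 0) + B₀ + B₁ + h 1 - h 0 by linarith)]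
end

section
/- Let V₁, V₂, X be smooth vector fields on an open set U ⊆ ℝ⁴ such that for every q ∈ U: (i) V₁(q), V₂(q), [V₁,V₂](q) are linearly independent; (ii) the vectors V₁(q), V₂(q), [V₁,V₂](q), [V₁,[V₁,V₂]](q), [V₂,[V₁,V₂]](q) span ℝ⁴; (iii) X(q) ∈ E_q := span{V₁(q), V₂(q), [V₁,V₂](q)}; and (iv) [X,V₁](q), [X,V₂](q), [X,[V₁,V₂]](q) all lie in E_q. Then X(q) ∈ span{V₁(q), V₂(q)} for every q ∈ U. (The kernel line field of the even-contact distribution associated to an Engel structure is contained in the Engel distribution.) -/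
open Real Set

/-- Lie bracket of vector fields on ℝ⁴: [V,W](q) = DW(q)(V(q)) − DV(q)(W(q)). -/
noncomputable def lie4 (V W : (Fin 4 → ℝ) → (Fin 4 → ℝ)) (q : Fin 4 → ℝ) : Fin 4 → ℝ :=
  fderiv ℝ W q (V q) - fderiv ℝ V q (W q)

open Topology in
/-- If a 1-form `ω` annihilates two vector fields `Y` and `Z` near `q`, then its value on their
bracket is given by the (tensorial) exterior derivative of `ω`. -/
lemma apply_lie4_of_annihilates {ω : (Fin 4 → ℝ) → (Fin 4 → ℝ) →L[ℝ] ℝ}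
    {Y Z : (Fin 4 → ℝ) → (Fin 4 → ℝ)} {q : Fin 4 → ℝ} (hω : DifferentiableAt ℝ ω q)
    (hY : DifferentiableAt ℝ Y q) (hZ : DifferentiableAt ℝ Z q)
    (hωY : ∀ᶠ p in 𝓝 q, ω p (Y p) = 0) (hωZ : ∀ᶠ p in 𝓝 q, ω p (Z p) = 0) :
    ω q (lie4 Y Z q) = fderiv ℝ ω q (Z q) (Y q) - fderiv ℝ ω q (Y q) (Z q) := by
  have key : ∀ {T : (Fin 4 → ℝ) → (Fin 4 → ℝ)}, DifferentiableAt ℝ T q →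
      (∀ᶠ p in 𝓝 q, ω p (T p) = 0) → ∀ u,
      ω q (fderiv ℝ T q u) = - fderiv ℝ ω q u (T q) := by
    intro T hT hωT u
    have h := (hω.hasFDerivAt.clm_apply hT.hasFDerivAt).congr_of_eventuallyEq
      (f₁ := fun _ ↦ (0 : ℝ)) (hωT.mono fun p hp ↦ hp.symm)
    have h' := congrArg (fun L ↦ L u) (h.unique (hasFDerivAt_const (0 : ℝ) q))
    simp at h'
    linarith
  rw [lie4, map_sub, key hZ hωZ, key hY hωY]
  ring

/-- The covector `v ↦ det (v, M₀, …, Mₙ₋₁)`, expanded along its first row. -/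
noncomputable def detCovector {n : ℕ} (M : Fin n → Fin (n + 1) → ℝ) :
    (Fin (n + 1) → ℝ) →L[ℝ] ℝ :=
  ∑ j : Fin (n + 1), ((-1) ^ (j : ℕ) * ((Matrix.of M).submatrix id j.succAbove).det) •
    ContinuousLinearMap.proj j

lemma detCovector_apply {n : ℕ} (M : Fin n → Fin (n + 1) → ℝ) (v : Fin (n + 1) → ℝ) :
    detCovector M v = (Matrix.of (Matrix.vecCons v M)).det := by
  rw [Matrix.det_succ_row_zero, detCovector, sum_apply]
  refine Finset.sum_congr rfl fun j _ ↦ ?_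
  simp only [smul_apply, ContinuousLinearMap.proj_apply, smul_eq_mul]
  rw [mul_right_comm]
  rfl

lemma detCovector_apply_self {n : ℕ} (M : Fin n → Fin (n + 1) → ℝ) (i : Fin n) :
    detCovector M (M i) = 0 := by
  rw [detCovector_apply]
  exact Matrix.det_zero_of_row_eq (Fin.succ_ne_zero i).symm rfl

lemma detCovector_ne_zero {n : ℕ} {M : Fin n → Fin (n + 1) → ℝ} (hM : LinearIndependent ℝ M) :
    detCovector M ≠ 0 := by
  obtain ⟨v, hv⟩ : ∃ v, v ∉ Submodule.span ℝ (range M) := by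
    by_contra! h
    have := finrank_span_eq_card hM
    rw [(Submodule.eq_top_iff'.2 h : Submodule.span ℝ (range M) = ⊤), finrank_top] at this
    simp at this
  intro h
  have hdet : (Matrix.of (Matrix.vecCons v M)).det = 0 := by simp [← detCovector_apply, h]
  have hli : LinearIndependent ℝ (Matrix.of (Matrix.vecCons v M)).row :=
    linearIndependent_finCons.2 ⟨hM, hv⟩
  rw [Matrix.linearIndependent_rows_iff_isUnit, Matrix.isUnit_iff_isUnit_det] at hli
  exact hli.ne_zero hdet

lemma DifferentiableAt.detCovector {E : Type*} [NormedAddCommGroup E] [NormedSpace ℝ E] {n : ℕ}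
    {M : E → Fin n → Fin (n + 1) → ℝ} {q : E} (hM : DifferentiableAt ℝ M q) :
    DifferentiableAt ℝ (fun p ↦ detCovector (M p)) q := by
  have hM' : ∀ i j, DifferentiableAt ℝ (fun p ↦ M p i j) q := fun i j ↦
    differentiableAt_pi.1 (differentiableAt_pi.1 hM i) j
  simp only [_root_.detCovector, Matrix.det_apply, Matrix.submatrix_apply, Matrix.of_apply]
  fun_prop

lemma ContDiffOn.lie4 {U : Set (Fin 4 → ℝ)} (hU : IsOpen U) {V W : (Fin 4 → ℝ) → (Fin 4 → ℝ)}
    (hV : ContDiffOn ℝ (⊤ : ℕ∞) V U) (hW : ContDiffOn ℝ (⊤ : ℕ∞) W U) :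
    ContDiffOn ℝ (⊤ : ℕ∞) (lie4 V W) U :=
  ((hW.fderiv_of_isOpen hU (by simp)).clm_apply hV).sub
    ((hV.fderiv_of_isOpen hU (by simp)).clm_apply hW)

/-- the kernel line field of the even-contact distribution associated to an
Engel structure D = span{V₁,V₂} is contained in D. -/
theorem engel_kernel_in_distribution
    (U : Set (Fin 4 → ℝ)) (hU : IsOpen U)
    (V₁ V₂ X : (Fin 4 → ℝ) → (Fin 4 → ℝ))
    (hV₁ : ContDiffOn ℝ (⊤ : ℕ∞) V₁ U) (hV₂ : ContDiffOn ℝ (⊤ : ℕ∞) V₂ U) (hX : ContDiffOn ℝ (⊤ : ℕ∞) X U)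
    (hind : ∀ q ∈ U, LinearIndependent ℝ ![V₁ q, V₂ q, lie4 V₁ V₂ q])
    (hspan : ∀ q ∈ U,
      Submodule.span ℝ
        ({V₁ q, V₂ q, lie4 V₁ V₂ q, lie4 V₁ (lie4 V₁ V₂) q, lie4 V₂ (lie4 V₁ V₂) q} :
          Set (Fin 4 → ℝ)) = ⊤)
    (hXE : ∀ q ∈ U,
      X q ∈ Submodule.span ℝ ({V₁ q, V₂ q, lie4 V₁ V₂ q} : Set (Fin 4 → ℝ)))
    (hXker : ∀ q ∈ U,
      lie4 X V₁ q ∈ Submodule.span ℝ ({V₁ q, V₂ q, lie4 V₁ V₂ q} : Set (Fin 4 → ℝ)) ∧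
      lie4 X V₂ q ∈ Submodule.span ℝ ({V₁ q, V₂ q, lie4 V₁ V₂ q} : Set (Fin 4 → ℝ)) ∧
      lie4 X (lie4 V₁ V₂) q ∈
        Submodule.span ℝ ({V₁ q, V₂ q, lie4 V₁ V₂ q} : Set (Fin 4 → ℝ))) :
    ∀ q ∈ U, X q ∈ Submodule.span ℝ ({V₁ q, V₂ q} : Set (Fin 4 → ℝ)) := by
  intro q hq
  set W := lie4 V₁ V₂ with hW_def
  let ω : (Fin 4 → ℝ) → (Fin 4 → ℝ) →L[ℝ] ℝ := fun p ↦ detCovector ![V₁ p, V₂ p, W p]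
  have hd : ∀ {Y : (Fin 4 → ℝ) → (Fin 4 → ℝ)}, ContDiffOn ℝ (⊤ : ℕ∞) Y U →
      DifferentiableAt ℝ Y q := fun hY ↦
    (hY.differentiableOn (by simp)).differentiableAt (hU.mem_nhds hq)
  have h1 := hd hV₁
  have h2 := hd hV₂
  have hW := hd (hV₁.lie4 hU hV₂)
  have hω : DifferentiableAt ℝ ω q := by
    refine DifferentiableAt.detCovector (differentiableAt_pi.2 fun i ↦ ?_)
    fin_cases i
    exacts [h1, h2, hW]
  have hω1 : ∀ p, ω p (V₁ p) = 0 := fun p ↦ detCovector_apply_self _ 0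
  have hω2 : ∀ p, ω p (V₂ p) = 0 := fun p ↦ detCovector_apply_self _ 1
  have hωW : ∀ p, ω p (W p) = 0 := fun p ↦ detCovector_apply_self _ 2
  have hωE : ∀ p, ∀ v ∈ Submodule.span ℝ ({V₁ p, V₂ p, W p} : Set (Fin 4 → ℝ)), ω p v = 0 := by
    intro p v hv
    obtain ⟨a, b, c, rfl⟩ := Submodule.mem_span_triple.1 hv
    simp [hω1, hω2, hωW]
  have hωX : ∀ᶠ p in nhds q, ω p (X p) = 0 :=
    (hU.mem_nhds hq |> Filter.eventually_of_mem) fun p hp ↦ hωE p _ (hXE p hp)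
  have hX1 := apply_lie4_of_annihilates hω (hd hX) h1 hωX (.of_forall hω1)
  have hX2 := apply_lie4_of_annihilates hω (hd hX) h2 hωX (.of_forall hω2)
  have h12 := apply_lie4_of_annihilates hω h1 h2 (.of_forall hω1) (.of_forall hω2)
  have h1W := apply_lie4_of_annihilates hω h1 hW (.of_forall hω1) (.of_forall hωW)
  have h2W := apply_lie4_of_annihilates hω h2 hW (.of_forall hω2) (.of_forall hωW)
  rw [hωE q _ (hXker q hq).1] at hX1
  rw [hωE q _ (hXker q hq).2.1] at hX2
  rw [← hW_def, hωW] at h12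
  obtain ⟨a, b, c, habc⟩ := Submodule.mem_span_triple.1 (hXE q hq)
  simp only [← habc, map_add, map_smul, add_apply, smul_apply, smul_eq_mul] at hX1 hX2
  have hc1 : c * ω q (lie4 V₁ W q) = 0 := by rw [h1W]; linear_combination hX1 + b * h12
  have hc2 : c * ω q (lie4 V₂ W q) = 0 := by rw [h2W]; linear_combination hX2 - a * h12
  have hc : c = 0 := by
    by_contra hc
    refine detCovector_ne_zero (hind q hq) (ContinuousLinearMap.coe_injective ?_)
    refine LinearMap.ext_on (hspan q hq) ?_
    rintro v (rfl | rfl | rfl | rfl | rfl)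
    exacts [hω1 q, hω2 q, hωW q, (mul_eq_zero.1 hc1).resolve_left hc,
      (mul_eq_zero.1 hc2).resolve_left hc]
  exact Submodule.mem_span_pair.2 ⟨a, b, by simpa [hc] using habc⟩
end

section
/- Let X, Y be smooth vector fields on an open set U ⊆ ℝ⁴ such that X(q), Y(q), [X,Y](q) are linearly independent for every q ∈ U. Let a, b, c, d : U → ℝ be smooth functions with (ad − bc)(q) ≠ 0 for all q, and set X′ = aX + bY, Y′ = cX + dY. Then for every q ∈ U: the vectors X′(q), Y′(q), [X′,Y′](q) are linearly independent and span the same 3-dimensional subspace E_q = span{X(q), Y(q), [X,Y](q)}, and the change-of-basis matrix from (X(q), Y(q), [X,Y](q)) to (X′(q), Y′(q), [X′,Y′](q)) has determinant ((ad − bc)(q))² > 0. In particular, the orientation of E_q determined by the ordered basis (X(q), Y(q), [X,Y](q)) does not depend on the chosen frame (X,Y) of the 2-plane distribution span{X,Y}; the distribution E is naturally oriented. -/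
open Real Set

/-- Invertible matrix combinations of a finite family have the same span. -/
theorem span_range_eq_of_matrix_combination {ι R V : Type*} [Fintype ι] [DecidableEq ι]
    [CommRing R] [AddCommGroup V] [Module R V] {v w : ι → V} {M : Matrix ι ι R}
    (hM : IsUnit M.det) (h : ∀ i, w i = ∑ j, M i j • v j) :
    Submodule.span R (Set.range w) = Submodule.span R (Set.range v) := by
  have le_span {v w : ι → V} {M : Matrix ι ι R} (h : ∀ i, w i = ∑ j, M i j • v j) :
      Submodule.span R (Set.range w) ≤ Submodule.span R (Set.range v) := by
    rw [Submodule.span_le]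
    rintro _ ⟨i, rfl⟩
    rw [h i]
    exact Submodule.sum_mem _ fun j _ =>
      Submodule.smul_mem _ _ (Submodule.subset_span (Set.mem_range_self j))
  refine le_antisymm (le_span h) (le_span (M := M⁻¹) fun i => ?_)
  simp only [h, Finset.smul_sum, smul_smul]
  rw [Finset.sum_comm]
  simp only [← Finset.sum_smul, ← Matrix.mul_apply, Matrix.nonsing_inv_mul M hM]
  simp [Matrix.one_apply]

/-- Invertible matrix combinations of a linearly independent family are independent. -/
theorem LinearIndependent.of_matrix_combination {ι K V : Type*} [Fintype ι] [DecidableEq ι]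
    [Field K] [AddCommGroup V] [Module K V] {v w : ι → V} {M : Matrix ι ι K}
    (hv : LinearIndependent K v) (hM : IsUnit M.det) (h : ∀ i, w i = ∑ j, M i j • v j) :
    LinearIndependent K w := by
  rw [linearIndependent_iff_card_eq_finrank_span] at hv ⊢
  rw [hv, Set.finrank, Set.finrank, span_range_eq_of_matrix_combination hM h]

/-- The Lie bracket after a pointwise change of frame. -/
theorem lie4_frame_change {X Y : (Fin 4 → ℝ) → (Fin 4 → ℝ)} {a b c d : (Fin 4 → ℝ) → ℝ}
    {q : Fin 4 → ℝ} (hX : DifferentiableAt ℝ X q) (hY : DifferentiableAt ℝ Y q)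
    (ha : DifferentiableAt ℝ a q) (hb : DifferentiableAt ℝ b q)
    (hc : DifferentiableAt ℝ c q) (hd : DifferentiableAt ℝ d q) :
    lie4 (fun q => a q • X q + b q • Y q) (fun q => c q • X q + d q • Y q) q =
      (fderiv ℝ c q (a q • X q + b q • Y q) - fderiv ℝ a q (c q • X q + d q • Y q)) • X q +
      (fderiv ℝ d q (a q • X q + b q • Y q) - fderiv ℝ b q (c q • X q + d q • Y q)) • Y q +
      (a q * d q - b q * c q) • lie4 X Y q := by
  have fderiv_frame {f g : (Fin 4 → ℝ) → ℝ} (hf : DifferentiableAt ℝ f q)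
      (hg : DifferentiableAt ℝ g q) :=
    ((hf.hasFDerivAt.smul hX.hasFDerivAt).add (hg.hasFDerivAt.smul hY.hasFDerivAt)).fderiv
  have h₁ : fderiv ℝ (fun q => a q • X q + b q • Y q) q = _ := fderiv_frame ha hb
  have h₂ : fderiv ℝ (fun q => c q • X q + d q • Y q) q = _ := fderiv_frame hc hd
  simp only [lie4, h₁, h₂, add_apply, smul_apply,
    ContinuousLinearMap.smulRight_apply, map_add, map_smul]
  module

/-- the 3-distribution E = span{X, Y, [X,Y]} and its orientation do not
depend on the chosen frame (X,Y) of the 2-plane distribution span{X,Y}: a frame change by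
(a b; c d) with ad − bc ≠ 0 changes the basis (X, Y, [X,Y]) by a matrix of determinant
(ad − bc)² > 0. -/
theorem natural_orientation_of_E
    (U : Set (Fin 4 → ℝ)) (hU : IsOpen U)
    (X Y : (Fin 4 → ℝ) → (Fin 4 → ℝ))
    (hX : ContDiffOn ℝ (⊤ : ℕ∞) X U) (hY : ContDiffOn ℝ (⊤ : ℕ∞) Y U)
    (hind : ∀ q ∈ U, LinearIndependent ℝ ![X q, Y q, lie4 X Y q])
    (a b c d : (Fin 4 → ℝ) → ℝ)
    (ha : ContDiffOn ℝ (⊤ : ℕ∞) a U) (hb : ContDiffOn ℝ (⊤ : ℕ∞) b U)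
    (hc : ContDiffOn ℝ (⊤ : ℕ∞) c U) (hd : ContDiffOn ℝ (⊤ : ℕ∞) d U)
    (hdet : ∀ q ∈ U, a q * d q - b q * c q ≠ 0)
    (X' Y' : (Fin 4 → ℝ) → (Fin 4 → ℝ))
    (hX' : X' = fun q => a q • X q + b q • Y q)
    (hY' : Y' = fun q => c q • X q + d q • Y q) :
    ∀ q ∈ U,
      LinearIndependent ℝ ![X' q, Y' q, lie4 X' Y' q] ∧
      Submodule.span ℝ ({X' q, Y' q, lie4 X' Y' q} : Set (Fin 4 → ℝ)) =
        Submodule.span ℝ ({X q, Y q, lie4 X Y q} : Set (Fin 4 → ℝ)) ∧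
      (∃ M : Matrix (Fin 3) (Fin 3) ℝ,
        (∀ i : Fin 3,
          (![X' q, Y' q, lie4 X' Y' q]) i =
            ∑ j : Fin 3, M i j • (![X q, Y q, lie4 X Y q]) j) ∧
        M.det = (a q * d q - b q * c q) ^ 2 ∧ 0 < M.det) := by
  intro q hq
  have hUq : U ∈ nhds q := hU.mem_nhds hq
  have differentiableAt {F : Type} [NormedAddCommGroup F] [NormedSpace ℝ F]
      {f : (Fin 4 → ℝ) → F} (hf : ContDiffOn ℝ (⊤ : ℕ∞) f U) : DifferentiableAt ℝ f q :=
    (hf.contDiffAt hUq).differentiableAt (by simp)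
  have hlie := lie4_frame_change (differentiableAt hX) (differentiableAt hY)
    (differentiableAt ha) (differentiableAt hb) (differentiableAt hc) (differentiableAt hd)
  rw [← hX', ← hY'] at hlie
  obtain ⟨M, hM, hMdet⟩ : ∃ M : Matrix (Fin 3) (Fin 3) ℝ,
      (∀ i, (![X' q, Y' q, lie4 X' Y' q]) i =
        ∑ j, M i j • (![X q, Y q, lie4 X Y q]) j) ∧
      M.det = (a q * d q - b q * c q) ^ 2 := by
    refine ⟨!![a q, b q, 0; c q, d q, 0;
      fderiv ℝ c q (a q • X q + b q • Y q) - fderiv ℝ a q (c q • X q + d q • Y q),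
      fderiv ℝ d q (a q • X q + b q • Y q) - fderiv ℝ b q (c q • X q + d q • Y q),
      a q * d q - b q * c q], fun i => ?_, ?_⟩
    · fin_cases i
      · simp [Fin.sum_univ_three, hX']
      · simp [Fin.sum_univ_three, hY']
      · simpa [Fin.sum_univ_three] using hlie
    · simp [Matrix.det_fin_three]
      ring
  have hpos : 0 < M.det := hMdet ▸ sq_pos_of_ne_zero (hdet q hq)
  have hunit : IsUnit M.det := hpos.ne'.isUnit
  refine ⟨(hind q hq).of_matrix_combination hunit hM, ?_, M, hM, hMdet, hpos⟩
  have range_triple (u v w : Fin 4 → ℝ) : Set.range ![u, v, w] = {u, v, w} := by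
    simp only [Matrix.range_cons, Matrix.range_empty, Set.union_empty, Set.singleton_union]
  simpa only [range_triple] using span_range_eq_of_matrix_combination hunit hM
end
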